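/- arXiv:2309.04176 — 8 statements merged into one kernel-verified Lean document; each statement's English description precedes it below -/
import Mathlib

section
/- Let g : ℝ → ℝ be twice continuously differentiable. For (z₁, z₂) ∈ ℂ² set S = |z₁|²·(1 + |z₂|²) and define the 2×2 Hermitian matrix M(z₁, z₂) with entries M₁₁ = (1 + |z₂|²)·(g'(S) + S·g''(S)), M₁₂ = conj(z₁)·z₂·(g'(S) + S·g''(S)), M₂₁ = z₁·conj(z₂)·(g'(S) + S·g''(S)), and M₂₂ = |z₁|²·(g'(S) + |z₁|²·|z₂|²·g''(S)) + 1/(1 + |z₂|²)². Then M(z₁, z₂) is positive definite for every (z₁, z₂) ∈ ℂ² if and only if the following three conditions hold: g'(0) > 0, and for all S > 0, 1/S + g'(S) > 0 and g'(S) + S·g''(S) > 0. -/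
open scoped ComplexConjugate ComplexOrder

/-- The coefficient matrix of the pullback of `ω = i∂∂̄(log S + g(S))` under the blow-up chart
`(z₁, z₂) ↦ (z₁, z₁·z₂)` of `Bl₀ℂ²`, where `S = |z₁|²·(1 + |z₂|²)`. -/
noncomputable def blowUpChartMatrix (g : ℝ → ℝ) (z₁ z₂ : ℂ) : Matrix (Fin 2) (Fin 2) ℂ :=
  let S : ℝ := ‖z₁‖ ^ 2 * (1 + ‖z₂‖ ^ 2)
  !![Complex.ofReal ((1 + ‖z₂‖ ^ 2) * (deriv g S + S * deriv (deriv g) S)),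
     conj z₁ * z₂ * Complex.ofReal (deriv g S + S * deriv (deriv g) S);
     z₁ * conj z₂ * Complex.ofReal (deriv g S + S * deriv (deriv g) S),
     Complex.ofReal (‖z₁‖ ^ 2 * (deriv g S + ‖z₁‖ ^ 2 * ‖z₂‖ ^ 2 * deriv (deriv g) S)
       + 1 / (1 + ‖z₂‖ ^ 2) ^ 2)]

/-- the matrix `M(z₁, z₂)` is positive definite for every `(z₁, z₂) ∈ ℂ²` iff
`g'(0) > 0` and, for all `S > 0`, `1/S + g'(S) > 0` and `g'(S) + S·g''(S) > 0`. -/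
theorem metric_extends_to_blowup_iff (g : ℝ → ℝ) (hg : ContDiff ℝ 2 g) :
    (∀ z₁ z₂ : ℂ, (blowUpChartMatrix g z₁ z₂).PosDef) ↔
      (0 < deriv g 0 ∧ ∀ S : ℝ, 0 < S →
        0 < 1 / S + deriv g S ∧ 0 < deriv g S + S * deriv (deriv g) S) := by
  constructor
  · intro h
    refine ⟨?_, fun S hS => ?_⟩
    · have h0 := (h 0 0).diag_pos (i := 0)
      simpa [blowUpChartMatrix] using h0
    · have hn : ‖((Real.sqrt S : ℝ) : ℂ)‖ ^ 2 = S := by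
        rw [Complex.norm_real, Real.norm_eq_abs, sq_abs, Real.sq_sqrt hS.le]
      have h0 := (h (Real.sqrt S : ℝ) 0).diag_pos (i := 0)
      have h1 := (h (Real.sqrt S : ℝ) 0).diag_pos (i := 1)
      simp only [blowUpChartMatrix, hn, Matrix.of_apply, Matrix.cons_val', Matrix.cons_val_zero,
        Matrix.cons_val_one, Matrix.cons_val_fin_one, norm_zero, Complex.zero_lt_real] at h0 h1
      norm_num at h0 h1
      refine ⟨?_, h0⟩
      have : 1 / S + deriv g S = (S * deriv g S + 1) / S := by field_simp; ring
      rw [this]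
      positivity
  · rintro ⟨hg0, hS⟩ z₁ z₂
    obtain ⟨S, hSdef⟩ : ∃ S : ℝ, S = ‖z₁‖ ^ 2 * (1 + ‖z₂‖ ^ 2) := ⟨_, rfl⟩
    have hb : 0 < 1 + ‖z₂‖ ^ 2 := by positivity
    have key : 0 < deriv g S + S * deriv (deriv g) S ∧
        0 < ‖z₁‖ ^ 2 * deriv g S + 1 / (1 + ‖z₂‖ ^ 2) := by
      by_cases hz : z₁ = 0
      · have : S = 0 := by simp [hSdef, hz]
        subst hz
        rw [this]
        refine ⟨by simpa using hg0, ?_⟩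
        simp only [norm_zero]
        have := one_div_pos.mpr hb
        linarith
      · have ha : 0 < ‖z₁‖ ^ 2 := by positivity
        have hSp : 0 < S := by rw [hSdef]; positivity
        refine ⟨(hS S hSp).2, ?_⟩
        have h1 := mul_pos ha (hS S hSp).1
        have : ‖z₁‖ ^ 2 * (1 / S + deriv g S) =
            ‖z₁‖ ^ 2 * deriv g S + 1 / (1 + ‖z₂‖ ^ 2) := by
          rw [hSdef]
          have := ha.ne'
          generalize deriv g _ = d
          field_simp
          ring
        rwa [this] at h1
    obtain ⟨hh, hc⟩ := key
    refine Matrix.PosDef.of_dotProduct_mulVec_pos ?_ ?_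
    · ext i j
      fin_cases i <;> fin_cases j <;> simp [blowUpChartMatrix, Matrix.conjTranspose_apply] <;>
        simp [← Complex.ofReal_pow, Complex.conj_ofReal]
    · intro x hx
      have hM : star x ⬝ᵥ (blowUpChartMatrix g z₁ z₂).mulVec x =
          (((deriv g S + S * deriv (deriv g) S) / (1 + ‖z₂‖ ^ 2) *
            ‖((1 + ‖z₂‖ ^ 2 : ℝ) : ℂ) * x 0 + conj z₁ * z₂ * x 1‖ ^ 2 +
            (‖z₁‖ ^ 2 * deriv g S + 1 / (1 + ‖z₂‖ ^ 2)) / (1 + ‖z₂‖ ^ 2) * ‖x 1‖ ^ 2 : ℝ) : ℂ) := by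
        have hne : (1 + z₂ * conj z₂ : ℂ) ≠ 0 := by
          rw [Complex.mul_conj']
          exact_mod_cast hb.ne'
        simp only [blowUpChartMatrix, ← hSdef, Matrix.mulVec, dotProduct, Fin.sum_univ_two,
          Matrix.of_apply, Matrix.cons_val', Matrix.cons_val_zero,
          Matrix.cons_val_one, Matrix.cons_val_fin_one, Pi.star_apply, RCLike.star_def]
        generalize deriv (deriv g) S = e
        generalize deriv g S = d
        subst hSdef
        push_cast
        simp only [← Complex.mul_conj', map_add, map_mul, map_one, Complex.conj_conj]
        rw [mul_comm (conj z₂) z₂]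
        field_simp
        ring
      rw [hM, Complex.zero_lt_real]
      by_cases h1 : x 1 = 0
      · have h0 : x 0 ≠ 0 := by
          intro h0
          apply hx
          ext i
          fin_cases i <;> simp [h0, h1]
        have : (((1 + ‖z₂‖ ^ 2 : ℝ) : ℂ)) ≠ 0 := by exact_mod_cast hb.ne'
        simp only [h1, mul_zero, add_zero, norm_zero]
        have := norm_pos_iff.mpr (mul_ne_zero this h0)
        have := mul_pos (div_pos hh hb) (pow_pos this 2)
        simpa using this
      · have := mul_pos (div_pos hc hb) (pow_pos (norm_pos_iff.mpr h1) 2)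
        have h2 := mul_nonneg (div_pos hh hb).le
          (sq_nonneg ‖((1 + ‖z₂‖ ^ 2 : ℝ) : ℂ) * x 0 + conj z₁ * z₂ * x 1‖)
        linarith
end

section
/- Let m ≥ 2 be a natural number and let g : ℝ → ℝ be three times continuously differentiable with g'(0) > 0 and, for all S > 0, 1/S + g'(S) > 0 and g'(S) + S·g''(S) > 0. Set f(S) = log S + g(S) and define A²(S) = ((2m−2)·(f'(S) + S·f''(S))⁴ + f'(S)²·(f'(S) + 3S·f''(S) + S²·f'''(S))²) / (f'(S)²·(f'(S) + S·f''(S))³·S). Then for every S > 0 the denominator f'(S)²·(f'(S) + S·f''(S))³·S is strictly positive (so A²(S) is finite), and A²(S) → +∞ as S → 0⁺. -/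
/-- The squared norm `|A|²` of the second fundamental form of the hypersphere
`Σ_S = {z ∈ ℂ^m : ‖z‖² = S}` with `U(m)`-invariant Kähler metric `i∂∂̄f(‖z‖²)`. -/
noncomputable def normSqSecondFundForm (m : ℕ) (f : ℝ → ℝ) (S : ℝ) : ℝ :=
  ((2 * (m : ℝ) - 2) * (deriv f S + S * deriv (deriv f) S) ^ 4
      + (deriv f S) ^ 2 *
          (deriv f S + 3 * S * deriv (deriv f) S + S ^ 2 * deriv (deriv (deriv f)) S) ^ 2)
    / ((deriv f S) ^ 2 * (deriv f S + S * deriv (deriv f) S) ^ 3 * S)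

/-- with `f(S) = log S + g(S)`, the denominator of `|A|²(S)` is strictly positive
for every `S > 0`, and `|A|²(S) → +∞` as `S → 0⁺`. -/
theorem normSq_second_fund_form_blows_up_only_at_zero (m : ℕ) (hm : 2 ≤ m) (g : ℝ → ℝ)
    (hg : ContDiff ℝ 3 g) (hg0 : 0 < deriv g 0)
    (hg1 : ∀ S : ℝ, 0 < S → 0 < 1 / S + deriv g S)
    (hg2 : ∀ S : ℝ, 0 < S → 0 < deriv g S + S * deriv (deriv g) S) :
    (∀ S : ℝ, 0 < S →
      0 < (deriv (fun S => Real.log S + g S) S) ^ 2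
          * (deriv (fun S => Real.log S + g S) S
              + S * deriv (deriv (fun S => Real.log S + g S)) S) ^ 3 * S)
    ∧ Filter.Tendsto (normSqSecondFundForm m (fun S => Real.log S + g S))
        (nhdsWithin 0 (Set.Ioi 0)) Filter.atTop := by
  have hg' : ContDiff ℝ 2 (deriv g) := by
    have h : ContDiff ℝ (2 + 1) g := by norm_num; exact hg
    exact (contDiff_succ_iff_deriv.1 h).2.2
  have hg'' : ContDiff ℝ 1 (deriv (deriv g)) := by
    have h : ContDiff ℝ (1 + 1) (deriv g) := by norm_num; exact hg'
    exact (contDiff_succ_iff_deriv.1 h).2.2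
  have d0 : Differentiable ℝ g := hg.differentiable (by norm_num)
  have d1 : Differentiable ℝ (deriv g) := hg'.differentiable (by norm_num)
  have d2 : Differentiable ℝ (deriv (deriv g)) := hg''.differentiable (by norm_num)
  have c3 : Continuous (deriv (deriv (deriv g))) := hg''.continuous_deriv (by norm_num)
  have hD : ∀ S : ℝ, 0 < S → deriv (fun S => Real.log S + g S) S = S⁻¹ + deriv g S ∧
      deriv (deriv (fun S => Real.log S + g S)) S = -(S ^ 2)⁻¹ + deriv (deriv g) S ∧
      deriv (deriv (deriv (fun S => Real.log S + g S))) S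
        = 2 * (S ^ 3)⁻¹ + deriv (deriv (deriv g)) S := by
    have e1 : ∀ S : ℝ, 0 < S → deriv (fun S => Real.log S + g S) S = S⁻¹ + deriv g S := by
      intro S hS
      exact ((Real.hasDerivAt_log hS.ne').add (d0 S).hasDerivAt).deriv
    have e2 : ∀ S : ℝ, 0 < S → deriv (deriv (fun S => Real.log S + g S)) S
        = -(S ^ 2)⁻¹ + deriv (deriv g) S := by
      intro S hS
      have : deriv (fun S => Real.log S + g S) =ᶠ[nhds S] fun S => S⁻¹ + deriv g S := by
        filter_upwards [lt_mem_nhds hS] with x hx using e1 x hx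
      rw [this.deriv_eq]
      exact ((hasDerivAt_inv hS.ne').add (d1 S).hasDerivAt).deriv
    refine fun S hS => ⟨e1 S hS, e2 S hS, ?_⟩
    have : deriv (deriv (fun S => Real.log S + g S)) =ᶠ[nhds S]
        fun S => -(S ^ 2)⁻¹ + deriv (deriv g) S := by
      filter_upwards [lt_mem_nhds hS] with x hx using e2 x hx
    rw [this.deriv_eq]
    have h := (((hasDerivAt_pow 2 S).fun_inv (pow_ne_zero 2 hS.ne')).fun_neg.fun_add
      (d2 S).hasDerivAt).deriv
    rw [h]
    field_simp
    norm_num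
    ring
  have hP : ∀ S : ℝ, 0 < S → S⁻¹ + deriv g S + S * (-(S ^ 2)⁻¹ + deriv (deriv g) S)
      = deriv g S + S * deriv (deriv g) S := by
    intro S hS
    field_simp
    ring
  have hQ : ∀ S : ℝ, 0 < S → S⁻¹ + deriv g S + 3 * S * (-(S ^ 2)⁻¹ + deriv (deriv g) S)
      + S ^ 2 * (2 * (S ^ 3)⁻¹ + deriv (deriv (deriv g)) S)
      = deriv g S + 3 * S * deriv (deriv g) S + S ^ 2 * deriv (deriv (deriv g)) S := by
    intro S hS
    field_simp
    ring
  have hF : ∀ S : ℝ, 0 < S → 0 < S⁻¹ + deriv g S := by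
    intro S hS
    simpa using hg1 S hS
  constructor
  · intro S hS
    obtain ⟨a, b, -⟩ := hD S hS
    rw [a, b, hP S hS]
    have := hF S hS
    have := hg2 S hS
    positivity
  · have hlim : Filter.Tendsto (fun S : ℝ =>
        (deriv g S + 3 * S * deriv (deriv g) S + S ^ 2 * deriv (deriv (deriv g)) S) ^ 2
          / (deriv g S + S * deriv (deriv g) S) ^ 3) (nhdsWithin 0 (Set.Ioi 0))
        (nhds ((deriv g 0) ^ 2 / (deriv g 0) ^ 3)) := by
      have c1 := d1.continuous
      have c2 := d2.continuous
      have : ContinuousAt (fun S : ℝ =>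
        (deriv g S + 3 * S * deriv (deriv g) S + S ^ 2 * deriv (deriv (deriv g)) S) ^ 2
          / (deriv g S + S * deriv (deriv g) S) ^ 3) 0 := by
        apply ContinuousAt.div
        · fun_prop
        · fun_prop
        · simpa using hg0.ne'
      have h := this.tendsto
      simp only [mul_zero, zero_mul, add_zero, ne_eq, OfNat.ofNat_ne_zero, not_false_eq_true,
        zero_pow] at h
      exact h.mono_left nhdsWithin_le_nhds
    have hT := hlim.pos_mul_atTop (by positivity) (tendsto_inv_nhdsGT_zero (𝕜 := ℝ))
    refine Filter.tendsto_atTop_mono' _ ?_ hT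
    filter_upwards [self_mem_nhdsWithin] with S hS
    have hS : 0 < S := hS
    obtain ⟨a, b, c⟩ := hD S hS
    unfold normSqSecondFundForm
    rw [a, b, c, hP S hS, hQ S hS]
    have h1 := hF S hS
    have h2 := hg2 S hS
    generalize S⁻¹ + deriv g S = F at *
    generalize deriv g S + S * deriv (deriv g) S = P at *
    generalize deriv g S + 3 * S * deriv (deriv g) S + S ^ 2 * deriv (deriv (deriv g)) S = Q at *
    have hm' : (0 : ℝ) ≤ 2 * (m : ℝ) - 2 := by
      have : (2 : ℝ) ≤ m := by exact_mod_cast hm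
      linarith
    have e : Q ^ 2 / P ^ 3 * S⁻¹ = F ^ 2 * Q ^ 2 / (F ^ 2 * P ^ 3 * S) := by
      field_simp
    rw [e]
    apply div_le_div_of_nonneg_right _ (by positivity)
    have : 0 ≤ (2 * (m : ℝ) - 2) * P ^ 4 := by positivity
    linarith
end

section
/- Let m ≥ 2 be a natural number and let g : ℝ → ℝ be three times continuously differentiable with g'(0) > 0 and, for all S > 0, 1/S + g'(S) > 0 and g'(S) + S·g''(S) > 0. Set f(S) = log S + g(S) and define A²(S) = ((2m−2)·(f'(S) + S·f''(S))⁴ + f'(S)²·(f'(S) + 3S·f''(S) + S²·f'''(S))²) / (f'(S)²·(f'(S) + S·f''(S))³·S). Then lim_{S→0⁺} S·A²(S) = 1/g'(0). -/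
/-- with `f(S) = log S + g(S)`, one has `S·|A|²(S) → 1/g'(0)` as `S → 0⁺`. -/
theorem normSq_second_fund_form_blow_up_rate (m : ℕ) (hm : 2 ≤ m) (g : ℝ → ℝ)
    (hg : ContDiff ℝ 3 g) (hg0 : 0 < deriv g 0)
    (hg1 : ∀ S : ℝ, 0 < S → 0 < 1 / S + deriv g S)
    (hg2 : ∀ S : ℝ, 0 < S → 0 < deriv g S + S * deriv (deriv g) S) :
    Filter.Tendsto (fun S => S * normSqSecondFundForm m (fun S => Real.log S + g S) S)
      (nhdsWithin 0 (Set.Ioi 0)) (nhds (1 / deriv g 0)) := by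
  have h1 : ContDiff ℝ 2 (deriv g) := ((contDiff_succ_iff_deriv (n := 2)).1 hg).2.2
  have h2 : ContDiff ℝ 1 (deriv (deriv g)) := ((contDiff_succ_iff_deriv (n := 1)).1 h1).2.2
  have h3 : Continuous (deriv (deriv (deriv g))) := h2.continuous_deriv le_rfl
  have c1 := h1.continuous
  have c2 := h2.continuous
  have dg : Differentiable ℝ g := hg.differentiable (by norm_num)
  have dg1 : Differentiable ℝ (deriv g) := h1.differentiable (by norm_num)
  have dg2 : Differentiable ℝ (deriv (deriv g)) := h2.differentiable (by norm_num)
  have e1 : ∀ S : ℝ, 0 < S →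
      deriv (fun S => Real.log S + g S) S = S⁻¹ + deriv g S := fun S hS =>
    ((Real.hasDerivAt_log hS.ne').add (dg S).hasDerivAt).deriv
  have e2 : ∀ S : ℝ, 0 < S →
      deriv (deriv (fun S => Real.log S + g S)) S = -(S ^ 2)⁻¹ + deriv (deriv g) S := by
    intro S hS
    have he : deriv (fun S => Real.log S + g S) =ᶠ[nhds S] fun S => S⁻¹ + deriv g S := by
      filter_upwards [lt_mem_nhds hS] with x hx using e1 x hx
    rw [he.deriv_eq]
    exact ((hasDerivAt_inv hS.ne').add (dg1 S).hasDerivAt).deriv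
  have e3 : ∀ S : ℝ, 0 < S →
      deriv (deriv (deriv (fun S => Real.log S + g S))) S
        = 2 / S ^ 3 + deriv (deriv (deriv g)) S := by
    intro S hS
    have he : deriv (deriv (fun S => Real.log S + g S)) =ᶠ[nhds S]
        fun S => -(S ^ 2)⁻¹ + deriv (deriv g) S := by
      filter_upwards [lt_mem_nhds hS] with x hx using e2 x hx
    rw [he.deriv_eq]
    have hp := (((hasDerivAt_pow 2 S).fun_inv (pow_ne_zero 2 hS.ne')).fun_neg).fun_add
      (dg2 S).hasDerivAt
    rw [hp.deriv]
    have := hS.ne'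
    congr 1
    field_simp
    norm_num
    ring
  have hlim : Filter.Tendsto (fun S : ℝ =>
      ((2 * (m : ℝ) - 2) * (deriv g S + S * deriv (deriv g) S) ^ 4 * S ^ 2
        + (1 + S * deriv g S) ^ 2 *
          (deriv g S + 3 * S * deriv (deriv g) S + S ^ 2 * deriv (deriv (deriv g)) S) ^ 2)
      / ((1 + S * deriv g S) ^ 2 * (deriv g S + S * deriv (deriv g) S) ^ 3))
      (nhds 0) (nhds (1 / deriv g 0)) := by
    have hc : ContinuousAt (fun S : ℝ =>
      ((2 * (m : ℝ) - 2) * (deriv g S + S * deriv (deriv g) S) ^ 4 * S ^ 2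
        + (1 + S * deriv g S) ^ 2 *
          (deriv g S + 3 * S * deriv (deriv g) S + S ^ 2 * deriv (deriv (deriv g)) S) ^ 2)
      / ((1 + S * deriv g S) ^ 2 * (deriv g S + S * deriv (deriv g) S) ^ 3)) 0 := by
      apply ContinuousAt.div
      · fun_prop
      · fun_prop
      · simp [hg0.ne']
    have ht := hc.tendsto
    convert ht using 2
    have := hg0.ne'
    simp
    field_simp
  refine (hlim.mono_left nhdsWithin_le_nhds).congr' ?_
  filter_upwards [self_mem_nhdsWithin] with S hS
  have hS : 0 < S := hS
  have hp := hg2 S hS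
  have hq := hg1 S hS
  rw [normSqSecondFundForm, e1 S hS, e2 S hS, e3 S hS]
  have hS' := hS.ne'
  have a1 : S⁻¹ + deriv g S = (1 + S * deriv g S) / S := by field_simp
  have a2 : S⁻¹ + deriv g S + S * (-(S ^ 2)⁻¹ + deriv (deriv g) S)
      = deriv g S + S * deriv (deriv g) S := by field_simp; ring
  have a3 : S⁻¹ + deriv g S + 3 * S * (-(S ^ 2)⁻¹ + deriv (deriv g) S)
      + S ^ 2 * (2 / S ^ 3 + deriv (deriv (deriv g)) S)
      = deriv g S + 3 * S * deriv (deriv g) S + S ^ 2 * deriv (deriv (deriv g)) S := by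
    field_simp; ring
  rw [a2, a3, a1]
  have hr : 0 < 1 + S * deriv g S := by
    have := mul_pos hS hq
    rwa [mul_add, mul_one_div_cancel hS'] at this
  generalize 1 + S * deriv g S = r at *
  generalize deriv g S + S * deriv (deriv g) S = p at *
  generalize deriv g S + 3 * S * deriv (deriv g) S + S ^ 2 * deriv (deriv (deriv g)) S = q at *
  have := hp.ne'
  have := hr.ne'
  field_simp
end

section
/- Let m ≥ 2 be a natural number and let g : ℝ → ℝ be three times continuously differentiable with g'(0) > 0 and, for all S > 0, 1/S + g'(S) > 0 and g'(S) + S·g''(S) > 0. Set f(S) = log S + g(S) and define H(S) = −((2m−2)·(f'(S) + S·f''(S))² + f'(S)·(S²·f'''(S) + 3S·f''(S) + f'(S))) / ((2m−1)·(f'(S) + S·f''(S))^{3/2}·√S·f'(S)). Then lim_{S→0⁺} √S·H(S) = −1/((2m−1)·√(g'(0))); in particular there exists ε > 0 such that H(S) < 0 for all S with 0 < S < ε. -/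
/-- The mean curvature `H(S)` of the hypersphere `Σ_S = {z ∈ ℂ^m : ‖z‖² = S}` with
`U(m)`-invariant Kähler metric `i∂∂̄f(‖z‖²)`. -/
noncomputable def meanCurvature (m : ℕ) (f : ℝ → ℝ) (S : ℝ) : ℝ :=
  -((2 * (m : ℝ) - 2) * (deriv f S + S * deriv (deriv f) S) ^ 2
      + deriv f S *
          (S ^ 2 * deriv (deriv (deriv f)) S + 3 * S * deriv (deriv f) S + deriv f S))
    / ((2 * (m : ℝ) - 1) * (deriv f S + S * deriv (deriv f) S) ^ ((3 : ℝ) / 2)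
        * Real.sqrt S * deriv f S)

/-- with `f(S) = log S + g(S)`, one has
`√S·H(S) → −1/((2m−1)·√(g'(0)))` as `S → 0⁺`; in particular `H(S) < 0` for all
sufficiently small `S > 0`. -/
theorem mean_curvature_negative_near_exceptional_divisor (m : ℕ) (hm : 2 ≤ m) (g : ℝ → ℝ)
    (hg : ContDiff ℝ 3 g) (hg0 : 0 < deriv g 0)
    (hg1 : ∀ S : ℝ, 0 < S → 0 < 1 / S + deriv g S)
    (hg2 : ∀ S : ℝ, 0 < S → 0 < deriv g S + S * deriv (deriv g) S) :
    Filter.Tendsto (fun S => Real.sqrt S * meanCurvature m (fun S => Real.log S + g S) S)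
        (nhdsWithin 0 (Set.Ioi 0))
        (nhds (-1 / ((2 * (m : ℝ) - 1) * Real.sqrt (deriv g 0))))
    ∧ ∃ ε : ℝ, 0 < ε ∧ ∀ S : ℝ, 0 < S → S < ε →
        meanCurvature m (fun S => Real.log S + g S) S < 0 := by
  have hm' : (2:ℝ) ≤ m := by exact_mod_cast hm
  have hd0 : Differentiable ℝ g := hg.differentiable (by norm_num)
  have h1 : ContDiff ℝ 2 (deriv g) := by
    have h : ContDiff ℝ (2 + 1) g := by convert hg using 1; norm_num
    exact (contDiff_succ_iff_deriv.1 h).2.2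
  have hd1 : Differentiable ℝ (deriv g) := h1.differentiable (by norm_num)
  have h2 : ContDiff ℝ 1 (deriv (deriv g)) := by
    have h : ContDiff ℝ (1 + 1) (deriv g) := by convert h1 using 1; norm_num
    exact (contDiff_succ_iff_deriv.1 h).2.2
  have hd2 : Differentiable ℝ (deriv (deriv g)) := h2.differentiable (by norm_num)
  have hc3 : Continuous (deriv (deriv (deriv g))) := h2.continuous_deriv (by norm_num)
  have hc1 := h1.continuous
  have hc2 := h2.continuous
  have e1 : ∀ S : ℝ, 0 < S → deriv (fun S => Real.log S + g S) S = S⁻¹ + deriv g S := by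
    intro S hS
    exact ((Real.hasDerivAt_log hS.ne').add (hd0 S).hasDerivAt).deriv
  have e2 : ∀ S : ℝ, 0 < S → deriv (deriv (fun S => Real.log S + g S)) S
      = -(S ^ 2)⁻¹ + deriv (deriv g) S := by
    intro S hS
    have : deriv (fun S => Real.log S + g S) =ᶠ[nhds S] fun S => S⁻¹ + deriv g S := by
      filter_upwards [lt_mem_nhds hS] with x hx using e1 x hx
    rw [this.deriv_eq]
    exact ((hasDerivAt_inv hS.ne').add (hd1 S).hasDerivAt).deriv
  have e3 : ∀ S : ℝ, 0 < S → deriv (deriv (deriv (fun S => Real.log S + g S))) S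
      = 2 / S ^ 3 + deriv (deriv (deriv g)) S := by
    intro S hS
    have : deriv (deriv (fun S => Real.log S + g S)) =ᶠ[nhds S]
        fun S => -(S ^ 2)⁻¹ + deriv (deriv g) S := by
      filter_upwards [lt_mem_nhds hS] with x hx using e2 x hx
    rw [this.deriv_eq]
    have hh := (((hasDerivAt_pow 2 S).fun_inv (by positivity)).fun_neg).fun_add (hd2 S).hasDerivAt
    rw [hh.deriv]
    congr 1
    field_simp
    norm_num
    ring
  have key : Filter.Tendsto
      (fun S => Real.sqrt S * meanCurvature m (fun S => Real.log S + g S) S)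
        (nhdsWithin 0 (Set.Ioi 0))
        (nhds (-1 / ((2 * (m : ℝ) - 1) * Real.sqrt (deriv g 0)))) := by
    let F : ℝ → ℝ := fun S =>
      -((2 * (m : ℝ) - 2) * S * (deriv g S + S * deriv (deriv g) S) ^ 2
        + (1 + S * deriv g S) * (S ^ 2 * deriv (deriv (deriv g)) S
          + 3 * S * deriv (deriv g) S + deriv g S))
      / ((2 * (m : ℝ) - 1) * (deriv g S + S * deriv (deriv g) S) ^ ((3 : ℝ) / 2)
        * (1 + S * deriv g S))
    have hr : ∀ x : ℝ, 0 < x → x ^ ((3:ℝ) / 2) = x * Real.sqrt x := by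
      intro x hx
      rw [Real.sqrt_eq_rpow, show (3:ℝ) / 2 = 1 + 1 / 2 by norm_num, Real.rpow_add hx,
        Real.rpow_one]
    have hF0 : F 0 = -1 / ((2 * (m : ℝ) - 1) * Real.sqrt (deriv g 0)) := by
      have : 0 < Real.sqrt (deriv g 0) := Real.sqrt_pos.2 hg0
      have h3 : (2 * (m:ℝ) - 1) ≠ 0 := by linarith
      simp only [F]
      simp only [zero_mul, mul_zero, add_zero, mul_one, one_mul, zero_add,
        ne_eq, OfNat.ofNat_ne_zero, not_false_eq_true, zero_pow]
      rw [hr _ hg0]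
      field_simp
    have hFc : ContinuousAt F 0 := by
      have hA : ContinuousAt (fun S => (deriv g S + S * deriv (deriv g) S) ^ ((3 : ℝ) / 2)) 0 := by
        apply ContinuousAt.rpow_const
        · fun_prop
        · right; norm_num
      apply ContinuousAt.div
      · fun_prop
      · fun_prop
      · have h3 : (2 * (m:ℝ) - 1) ≠ 0 := by linarith
        have : 0 < (deriv g 0) ^ ((3:ℝ) / 2) := Real.rpow_pos_of_pos hg0 _
        simp only [zero_mul, add_zero, mul_one]
        exact mul_ne_zero h3 this.ne'
    rw [← hF0]
    refine (hFc.tendsto.mono_left nhdsWithin_le_nhds).congr' ?_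
    filter_upwards [self_mem_nhdsWithin] with S hS
    have hS : 0 < S := hS
    have hA := hg2 S hS
    have hB := hg1 S hS
    simp only [F, meanCurvature]
    rw [e1 S hS, e2 S hS, e3 S hS]
    have a1 : S⁻¹ + deriv g S + S * (-(S ^ 2)⁻¹ + deriv (deriv g) S)
        = deriv g S + S * deriv (deriv g) S := by field_simp; ring
    have a2 : S ^ 2 * (2 / S ^ 3 + deriv (deriv (deriv g)) S)
        + 3 * S * (-(S ^ 2)⁻¹ + deriv (deriv g) S) + (S⁻¹ + deriv g S)
        = S ^ 2 * deriv (deriv (deriv g)) S + 3 * S * deriv (deriv g) S + deriv g S := by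
      field_simp; ring
    have a3 : 1 + S * deriv g S = S * (S⁻¹ + deriv g S) := by field_simp
    rw [a1, a2, a3]
    rw [one_div] at hB
    have hP : 0 < (deriv g S + S * deriv (deriv g) S) ^ ((3:ℝ) / 2) := Real.rpow_pos_of_pos hA _
    have hq : 0 < Real.sqrt S := Real.sqrt_pos.2 hS
    have h3 : (2 * (m:ℝ) - 1) ≠ 0 := by linarith
    generalize (deriv g S + S * deriv (deriv g) S) ^ ((3:ℝ) / 2) = P at *
    generalize S⁻¹ + deriv g S = Q at *
    generalize Real.sqrt S = q at *
    rw [mul_div_assoc', div_eq_div_iff (by positivity) (by positivity)]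
    ring
  refine ⟨key, ?_⟩
  have hneg : -1 / ((2 * (m : ℝ) - 1) * Real.sqrt (deriv g 0)) < 0 := by
    have : 0 < Real.sqrt (deriv g 0) := Real.sqrt_pos.2 hg0
    have h3 : 0 < (2 * (m:ℝ) - 1) := by linarith
    exact div_neg_of_neg_of_pos (by norm_num) (by positivity)
  have hev := key.eventually (gt_mem_nhds hneg)
  obtain ⟨ε, hε, h⟩ := mem_nhdsGT_iff_exists_Ioo_subset.1 hev
  refine ⟨ε, hε, fun S h0 h1 => ?_⟩
  have hh : Real.sqrt S * meanCurvature m (fun S => Real.log S + g S) S < 0 := h ⟨h0, h1⟩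
  exact neg_of_mul_neg_right hh (Real.sqrt_nonneg S)
end

section
/- Let m ≥ 2 be a natural number and let g : ℝ → ℝ be real-analytic on a neighborhood of [0,∞) with g'(0) > 0 and, for all S > 0, 1/S + g'(S) > 0 and g'(S) + S·g''(S) > 0. Set f(S) = log S + g(S), H(S) = −((2m−2)·(f'(S) + S·f''(S))² + f'(S)·(S²·f'''(S) + 3S·f''(S) + f'(S))) / ((2m−1)·(f'(S) + S·f''(S))^{3/2}·√S·f'(S)), and h(R) = H(R²) for R > 0. Then there exists ε > 0 such that for every R₀ with 0 < R₀ < ε there exist a finite time T > 0 and a differentiable function R : [0, T) → (0, ∞) with R(0) = R₀, R'(t) = h(R(t)) for all t ∈ [0, T), and R(t) → 0 as t → T⁻. -/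
theorem collapse_aux (φ : ℝ → ℝ) (δ : ℝ) (hδ : 0 < δ)
    (hc : ContinuousOn φ (Set.Icc 0 δ)) (hp : ∀ s ∈ Set.Icc 0 δ, 0 < φ s)
    (s₀ : ℝ) (h0 : 0 < s₀) (h1 : s₀ < δ) :
    ∃ T : ℝ, 0 < T ∧ ∃ S : ℝ → ℝ, Continuous S ∧ S 0 = s₀ ∧ S T = 0 ∧
      ∀ t ∈ Set.Ico (0 : ℝ) T, 0 < S t ∧ S t ≤ s₀ ∧ HasDerivAt S (-(2 * φ (S t))) t := by
  set p : ℝ → ℝ := Set.IccExtend hδ.le ((Set.Icc 0 δ).domRestrict φ) with hpdef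
  have pc : Continuous p := (continuousOn_iff_continuous_domRestrict.1 hc).Icc_extend'
  have ppos : ∀ s, 0 < p s := fun s => hp _ (Set.projIcc 0 δ hδ.le s).2
  have peq : ∀ s ∈ Set.Icc 0 δ, p s = φ s := fun s hs => by
    rw [hpdef, Set.IccExtend_of_mem _ _ hs]; rfl
  obtain ⟨M, hM⟩ := (isCompact_Icc.image_of_continuousOn hc).bddAbove
  have pM : ∀ s, p s ≤ M := fun s => hM ⟨_, (Set.projIcc 0 δ hδ.le s).2, rfl⟩
  have Mpos : 0 < M := (ppos 0).trans_le (pM 0)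
  set q : ℝ → ℝ := fun s => (2 * p s)⁻¹ with hq
  have qpos : ∀ s, 0 < q s := fun s => by have := ppos s; simp only [hq]; positivity
  have qc : Continuous q := (continuous_const.mul pc).inv₀ fun s => by
    have := ppos s
    exact (by linarith : (0:ℝ) < 2 * p s).ne'
  set G : ℝ → ℝ := fun s => ∫ u in (0:ℝ)..s, q u with hG
  have Gd : ∀ s, HasDerivAt G (q s) s := fun s =>
    intervalIntegral.integral_hasDerivAt_right (qc.intervalIntegrable _ _)
      (qc.stronglyMeasurableAtFilter _ _) qc.continuousAt
  have G0 : G 0 = 0 := by simp [hG]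
  have Gmono : StrictMono G := strictMono_of_deriv_pos fun s => by rw [(Gd s).deriv]; exact qpos s
  have Gcont : Continuous G := continuous_iff_continuousAt.2 fun s => (Gd s).continuousAt
  set c : ℝ := (2 * M)⁻¹ with hcdef
  have cpos : 0 < c := by positivity
  have hmono : Monotone fun s => G s - c * s := by
    have hd : ∀ s, HasDerivAt (fun s => G s - c * s) (q s - c * 1) s := fun s =>
      (Gd s).sub ((hasDerivAt_id s).const_mul c)
    refine monotone_of_deriv_nonneg (fun s => (hd s).differentiableAt) fun s => ?_
    rw [(hd s).deriv]
    have : c ≤ q s := by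
      simp only [hcdef, hq]
      have := ppos s
      have := pM s
      gcongr
    linarith
  have Gsurj : Function.Surjective G := by
    refine Gcont.surjective ?_ ?_
    · refine Filter.tendsto_atTop_mono' _ ?_ (Filter.tendsto_id.const_mul_atTop cpos)
      filter_upwards [Filter.eventually_ge_atTop 0] with s hs
      have := hmono hs
      simp only [G0] at this
      simp only [id]
      linarith
    · refine Filter.tendsto_atBot_mono' _ ?_ (Filter.tendsto_id.const_mul_atBot cpos)
      filter_upwards [Filter.eventually_le_atBot 0] with s hs
      have := hmono hs
      simp only [G0] at this
      simp only [id]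
      linarith
  set e := Gmono.orderIsoOfSurjective G Gsurj with he
  have eG : ∀ s, e s = G s := fun s => rfl
  have Ge : ∀ y, G (e.symm y) = y := fun y => e.apply_symm_apply y
  have ec : Continuous e.symm := e.symm.continuous
  have einv : ∀ s, e.symm (G s) = s := fun s => e.symm_apply_apply s
  refine ⟨G s₀, by rw [← G0]; exact Gmono h0, fun t => e.symm (G s₀ - t), by fun_prop, ?_, ?_, ?_⟩
  · simp [einv]
  · have := einv 0
    rw [G0] at this
    simpa using this
  · intro t ht
    have a1 : 0 < e.symm (G s₀ - t) := by
      rw [← Gmono.lt_iff_lt, Ge, G0]; linarith [ht.2]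
    have a2 : e.symm (G s₀ - t) ≤ s₀ := by
      rw [← Gmono.le_iff_le, Ge]; linarith [ht.1]
    refine ⟨a1, a2, ?_⟩
    have hd : HasDerivAt e.symm (q (e.symm (G s₀ - t)))⁻¹ (G s₀ - t) :=
      HasDerivAt.of_local_left_inverse ec.continuousAt (Gd _) (qpos _).ne'
        (Filter.Eventually.of_forall Ge)
    have h2 := hd.scomp t ((hasDerivAt_id t).const_sub (G s₀))
    have h3 : (q (e.symm (G s₀ - t)))⁻¹ = 2 * φ (e.symm (G s₀ - t)) := by
      simp only [hq, inv_inv]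
      rw [peq _ ⟨a1.le, by linarith⟩]
    rw [h3] at h2
    simpa [Function.comp_def] using h2

theorem meanCurvature_aux (m : ℕ) (hm : 2 ≤ m) (g : ℝ → ℝ)
    (hg : ∀ x ∈ Set.Ici (0 : ℝ), AnalyticAt ℝ g x)
    (hg1 : ∀ S : ℝ, 0 < S → 0 < 1 / S + deriv g S)
    (hg2 : ∀ S : ℝ, 0 < S → 0 < deriv g S + S * deriv (deriv g) S) (S : ℝ) (hS : 0 < S) :
    meanCurvature m (fun S => Real.log S + g S) S =
      -(((2 * (m : ℝ) - 2) * (deriv g S + S * deriv (deriv g) S) ^ 2 * (S / (1 + S * deriv g S))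
        + (deriv g S + 3 * S * deriv (deriv g) S + S ^ 2 * deriv (deriv (deriv g)) S))
        / ((2 * (m : ℝ) - 1) * (deriv g S + S * deriv (deriv g) S) ^ ((3 : ℝ) / 2)))
        / Real.sqrt S := by
  have d1 : ∀ x : ℝ, 0 < x → deriv (fun S => Real.log S + g S) x = x⁻¹ + deriv g x := fun x hx =>
    ((Real.hasDerivAt_log hx.ne').add (hg x hx.le).differentiableAt.hasDerivAt).deriv
  have d2 : ∀ x : ℝ, 0 < x → deriv (deriv (fun S => Real.log S + g S)) x
      = -(x ^ 2)⁻¹ + deriv (deriv g) x := fun x hx => by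
    have : deriv (fun S => Real.log S + g S) =ᶠ[nhds x] fun x => x⁻¹ + deriv g x := by
      filter_upwards [lt_mem_nhds hx] with y hy using d1 y hy
    rw [this.deriv_eq]
    exact ((hasDerivAt_inv hx.ne').add (hg x hx.le).deriv.differentiableAt.hasDerivAt).deriv
  have d3 : deriv (deriv (deriv (fun S => Real.log S + g S))) S
      = 2 / S ^ 3 + deriv (deriv (deriv g)) S := by
    have : deriv (deriv (fun S => Real.log S + g S)) =ᶠ[nhds S]
        fun x => -(x ^ 2)⁻¹ + deriv (deriv g) x := by
      filter_upwards [lt_mem_nhds hS] with y hy using d2 y hy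
    rw [this.deriv_eq]
    have h := ((((hasDerivAt_pow 2 S).inv (by positivity)).neg).add
      (hg S hS.le).deriv.deriv.differentiableAt.hasDerivAt).deriv
    refine Eq.trans h ?_
    congr 1
    field_simp
    norm_num
    try ring
  have hA := hg2 S hS
  have hF := hg1 S hS
  have hF' : 0 < 1 + S * deriv g S := by
    have := mul_pos hS hF
    have e : S * (1 / S + deriv g S) = 1 + S * deriv g S := by field_simp
    linarith
  unfold meanCurvature
  rw [d1 S hS, d2 S hS, d3]
  have eA : S⁻¹ + deriv g S + S * (-(S ^ 2)⁻¹ + deriv (deriv g) S)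
      = deriv g S + S * deriv (deriv g) S := by field_simp; ring
  have eB : S ^ 2 * (2 / S ^ 3 + deriv (deriv (deriv g)) S)
      + 3 * S * (-(S ^ 2)⁻¹ + deriv (deriv g) S) + (S⁻¹ + deriv g S)
      = deriv g S + 3 * S * deriv (deriv g) S + S ^ 2 * deriv (deriv (deriv g)) S := by
    field_simp; ring
  have eF : S⁻¹ + deriv g S = (1 + S * deriv g S) / S := by field_simp
  rw [eA, eB, eF]
  have hP : 0 < (deriv g S + S * deriv (deriv g) S) ^ ((3 : ℝ) / 2) := Real.rpow_pos_of_pos hA _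
  have hm' : (0:ℝ) < 2 * (m : ℝ) - 1 := by
    have : (2:ℝ) ≤ m := by exact_mod_cast hm
    linarith
  have hs := Real.sqrt_pos.2 hS
  generalize (deriv g S + S * deriv (deriv g) S) ^ ((3 : ℝ) / 2) = P at *
  generalize Real.sqrt S = r at *
  generalize 2 * (m : ℝ) - 1 = k at *
  generalize 1 + S * deriv g S = F at *
  generalize deriv g S + S * deriv (deriv g) S = A at *
  field_simp

/-- for `g` real-analytic on a neighborhood of `[0,∞)` satisfying the extension
conditions, there is `ε > 0` such that for every initial radius `R₀ < ε` the mean curvature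
flow ODE `R' = h(R)`, `h(R) = H(R²)`, has a solution starting at `R₀` that collapses to `0`
(the exceptional divisor) in finite time `T`. -/
theorem mcf_collapses_to_exceptional_divisor (m : ℕ) (hm : 2 ≤ m) (g : ℝ → ℝ)
    (hg : ∀ x ∈ Set.Ici (0 : ℝ), AnalyticAt ℝ g x) (hg0 : 0 < deriv g 0)
    (hg1 : ∀ S : ℝ, 0 < S → 0 < 1 / S + deriv g S)
    (hg2 : ∀ S : ℝ, 0 < S → 0 < deriv g S + S * deriv (deriv g) S) :
    ∃ ε : ℝ, 0 < ε ∧ ∀ R₀ : ℝ, 0 < R₀ → R₀ < ε →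
      ∃ T : ℝ, 0 < T ∧ ∃ R : ℝ → ℝ,
        (∀ t ∈ Set.Ico (0 : ℝ) T, 0 < R t) ∧ R 0 = R₀ ∧
        (∀ t ∈ Set.Ico (0 : ℝ) T,
          HasDerivWithinAt R (meanCurvature m (fun S => Real.log S + g S) ((R t) ^ 2))
            (Set.Ico (0 : ℝ) T) t) ∧
        Filter.Tendsto R (nhdsWithin T (Set.Iio T)) (nhds 0) := by
  have hm' : (0:ℝ) < 2 * (m : ℝ) - 1 := by
    have : (2:ℝ) ≤ m := by exact_mod_cast hm
    linarith
  have hmc := meanCurvature_aux m hm g hg hg1 hg2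
  set φ : ℝ → ℝ := fun S =>
    ((2 * (m : ℝ) - 2) * (deriv g S + S * deriv (deriv g) S) ^ 2 * (S / (1 + S * deriv g S))
        + (deriv g S + 3 * S * deriv (deriv g) S + S ^ 2 * deriv (deriv (deriv g)) S))
        / ((2 * (m : ℝ) - 1) * (deriv g S + S * deriv (deriv g) S) ^ ((3 : ℝ) / 2)) with hφ
  have hA : ∀ S, 0 ≤ S → 0 < deriv g S + S * deriv (deriv g) S := fun S hS => by
    rcases hS.eq_or_lt with rfl | h
    · simpa using hg0
    · exact hg2 S h
  have hF : ∀ S, 0 ≤ S → 0 < 1 + S * deriv g S := fun S hS => by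
    rcases hS.eq_or_lt with rfl | h
    · simp
    · have := mul_pos h (hg1 S h)
      have e : S * (1 / S + deriv g S) = 1 + S * deriv g S := by field_simp
      linarith
  have hcont : ∀ S, 0 ≤ S → ContinuousAt φ S := fun S hS => by
    have c1 := (hg S hS).deriv.continuousAt
    have c2 := (hg S hS).deriv.deriv.continuousAt
    have c3 := (hg S hS).deriv.deriv.deriv.continuousAt
    have cA : ContinuousAt (fun S => deriv g S + S * deriv (deriv g) S) S :=
      c1.add (continuousAt_id.mul c2)
    have cF : ContinuousAt (fun S => S / (1 + S * deriv g S)) S :=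
      continuousAt_id.div (continuousAt_const.add (continuousAt_id.mul c1)) (hF S hS).ne'
    have cP : ContinuousAt (fun S => (deriv g S + S * deriv (deriv g) S) ^ ((3 : ℝ) / 2)) S :=
      cA.rpow_const (Or.inl (hA S hS).ne')
    refine ContinuousAt.div ?_ (continuousAt_const.mul cP)
      (mul_pos hm' (Real.rpow_pos_of_pos (hA S hS) _)).ne'
    exact ((continuousAt_const.mul (cA.pow 2)).mul cF).add
      ((c1.add ((continuousAt_const.mul continuousAt_id).mul c2)).add
        ((continuousAt_id.pow 2).mul c3))
  have hφ0 : 0 < φ 0 := by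
    have := Real.rpow_pos_of_pos hg0 ((3:ℝ)/2)
    simp only [hφ]
    simp only [zero_mul, zero_div, mul_zero, add_zero, zero_add, ne_eq, OfNat.ofNat_ne_zero,
      not_false_eq_true, zero_pow]
    positivity
  obtain ⟨η, hη, hηp⟩ := Metric.eventually_nhds_iff.1 ((hcont 0 le_rfl).eventually_const_lt hφ0)
  have hpos : ∀ s ∈ Set.Icc 0 (η / 2), 0 < φ s := fun s hs => hηp (by
    rw [Real.dist_eq, sub_zero, abs_of_nonneg hs.1]; linarith [hs.2])
  refine ⟨Real.sqrt (η / 2), Real.sqrt_pos.2 (by positivity), fun R₀ hR hR' => ?_⟩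
  obtain ⟨T, hT, S, Sc, S0, ST, hS⟩ := collapse_aux φ (η / 2) (by positivity)
    (fun s hs => (hcont s hs.1).continuousWithinAt) hpos (R₀ ^ 2) (by positivity)
    ((Real.lt_sqrt hR.le).1 hR')
  refine ⟨T, hT, fun t => Real.sqrt (S t), fun t ht => Real.sqrt_pos.2 (hS t ht).1, ?_, ?_, ?_⟩
  · simp only [S0]; exact Real.sqrt_sq hR.le
  · intro t ht
    obtain ⟨h1, -, h3⟩ := hS t ht
    simp only [Real.sq_sqrt h1.le]
    rw [hmc _ h1]
    have h4 := (h3.sqrt h1.ne').hasDerivWithinAt (s := Set.Ico 0 T)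
    refine h4.congr_deriv ?_
    have hs := Real.sqrt_pos.2 h1
    change _ = -(φ (S t)) / _
    field_simp
  · have : Filter.Tendsto (fun t => Real.sqrt (S t)) (nhds T) (nhds (Real.sqrt (S T))) :=
      (Real.continuous_sqrt.comp Sc).continuousAt
    rw [ST, Real.sqrt_zero] at this
    exact this.mono_left nhdsWithin_le_nhds
end

section
/- Let m ≥ 2 be a natural number and let g : ℝ → ℝ be real-analytic on a neighborhood of [0,∞) with g'(0) > 0 and, for all S > 0, 1/S + g'(S) > 0 and g'(S) + S·g''(S) > 0. Set f(S) = log S + g(S), define h(R) = H(R²) where H(S) = −((2m−2)·(f'(S) + S·f''(S))² + f'(S)·(S²·f'''(S) + 3S·f''(S) + f'(S))) / ((2m−1)·(f'(S) + S·f''(S))^{3/2}·√S·f'(S)), and define A²(S) = ((2m−2)·(f'(S) + S·f''(S))⁴ + f'(S)²·(f'(S) + 3S·f''(S) + S²·f'''(S))²) / (f'(S)²·(f'(S) + S·f''(S))³·S). Suppose T ∈ (0, ∞) and R : [0, T) → (0, ∞) is differentiable with R'(t) = h(R(t)) for all t ∈ [0, T) and R(t) → 0 as t → T⁻. Then there exists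 a constant C > 0 such that A²(R(t)²) ≤ C/(T − t) for all t ∈ [0, T). -/
open Filter Topology Set in
theorem aux_derivs (g : ℝ → ℝ) (hg : ∀ x ∈ Set.Ici (0 : ℝ), AnalyticAt ℝ g x) :
    (∀ S : ℝ, 0 < S → deriv (fun S => Real.log S + g S) S = S⁻¹ + deriv g S) ∧
    (∀ S : ℝ, 0 < S → deriv (deriv (fun S => Real.log S + g S)) S
      = -(S ^ 2)⁻¹ + deriv (deriv g) S) ∧
    (∀ S : ℝ, 0 < S → deriv (deriv (deriv (fun S => Real.log S + g S))) S
      = 2 * (S ^ 3)⁻¹ + deriv (deriv (deriv g)) S) := by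
  have h1 : ∀ S : ℝ, 0 < S → deriv (fun S => Real.log S + g S) S = S⁻¹ + deriv g S := by
    intro S hS
    exact ((Real.hasDerivAt_log hS.ne').add
      (hg S hS.le).differentiableAt.hasDerivAt).deriv
  have h2 : ∀ S : ℝ, 0 < S → deriv (deriv (fun S => Real.log S + g S)) S
      = -(S ^ 2)⁻¹ + deriv (deriv g) S := by
    intro S hS
    have he : deriv (fun S => Real.log S + g S) =ᶠ[𝓝 S] fun S => S⁻¹ + deriv g S := by
      filter_upwards [Ioi_mem_nhds hS] with x hx using h1 x hx
    rw [he.deriv_eq]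
    exact ((hasDerivAt_inv hS.ne').add
      (hg S hS.le).deriv.differentiableAt.hasDerivAt).deriv
  refine ⟨h1, h2, ?_⟩
  intro S hS
  have he : deriv (deriv (fun S => Real.log S + g S)) =ᶠ[𝓝 S]
      fun S => -(S ^ 2)⁻¹ + deriv (deriv g) S := by
    filter_upwards [Ioi_mem_nhds hS] with x hx using h2 x hx
  rw [he.deriv_eq]
  have h3 : HasDerivAt (fun S : ℝ => -(S ^ 2)⁻¹) (2 * (S ^ 3)⁻¹) S := by
    have := ((hasDerivAt_pow 2 S).fun_inv (by positivity)).fun_neg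
    refine this.congr_deriv ?_
    push_cast
    field_simp
    try ring
  exact (h3.add (hg S hS.le).deriv.deriv.differentiableAt.hasDerivAt).deriv

open Filter Topology Set in
theorem aux_main (T : ℝ) (hT : 0 < T) (R N K : ℝ → ℝ)
    (hRpos : ∀ t ∈ Set.Ico (0 : ℝ) T, 0 < R t)
    (hN : ∀ S ∈ Set.Ici (0:ℝ), ContinuousAt N S)
    (hK : ContinuousAt K 0) (hK0 : 0 < K 0)
    (hode : ∀ t ∈ Set.Ico (0 : ℝ) T,
      HasDerivWithinAt R (-K (R t ^ 2) / R t) (Set.Ico (0 : ℝ) T) t)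
    (hlim : Tendsto R (𝓝[<] T) (𝓝 0)) :
    ∃ C : ℝ, 0 < C ∧ ∀ t ∈ Set.Ico (0 : ℝ) T, N (R t ^ 2) / R t ^ 2 ≤ C / (T - t) := by
  have hlim2 : Tendsto (fun t => R t ^ 2) (𝓝[<] T) (𝓝 0) := by
    simpa using hlim.pow 2
  have e1 : ∀ᶠ t in 𝓝[<] T, K 0 / 2 < K (R t ^ 2) :=
    (hK.tendsto.comp hlim2).eventually_const_lt (by linarith)
  have e2 : ∀ᶠ t in 𝓝[<] T, N (R t ^ 2) < |N 0| + 1 :=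
    ((hN 0 (by simp)).tendsto.comp hlim2).eventually_lt_const
      (by linarith [le_abs_self (N 0)])
  obtain ⟨l, hl, hlT⟩ := (mem_nhdsLT_iff_exists_Ioo_subset' (show T - 1 < T by linarith)).1
    (e1.and e2)
  have hl' : l < T := hl
  obtain ⟨t0, h0, ht0⟩ : ∃ t0, max 0 l < t0 ∧ t0 < T := exists_between (max_lt hT hl')
  have h00 : 0 < t0 := (le_max_left _ _).trans_lt h0
  have h0l : l < t0 := (le_max_right _ _).trans_lt h0
  have hsub : ∀ t ∈ Ico t0 T, K 0 / 2 < K (R t ^ 2) ∧ N (R t ^ 2) < |N 0| + 1 :=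
    fun t ht => hlT ⟨h0l.trans_le ht.1, ht.2⟩
  have hRc : ContinuousOn R (Ico 0 T) := fun t ht => (hode t ht).continuousWithinAt
  -- lower bound
  have hlow : ∀ t ∈ Ico t0 T, K 0 * (T - t) ≤ R t ^ 2 := by
    have hd : ∀ t ∈ Ioo t0 T, HasDerivAt (fun t => R t ^ 2 + K 0 * t)
        (-2 * K (R t ^ 2) + K 0) t := by
      intro t ht
      have htt : t ∈ Ico 0 T := ⟨(h00.trans ht.1).le, ht.2⟩
      have h := (hode t htt).hasDerivAt (Ico_mem_nhds (h00.trans ht.1) ht.2)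
      have hp := hRpos t htt
      refine ((h.fun_pow 2).fun_add ((hasDerivAt_id' t).const_mul (K 0))).congr_deriv ?_
      push_cast
      field_simp
      try ring
    have hanti : AntitoneOn (fun t => R t ^ 2 + K 0 * t) (Ico t0 T) := by
      apply antitoneOn_of_deriv_nonpos (convex_Ico _ _)
      · have := hRc.mono (Ico_subset_Ico_left h00.le)
        fun_prop
      · rw [interior_Ico]
        exact fun t ht => (hd t ht).differentiableAt.differentiableWithinAt
      · rw [interior_Ico]
        intro t ht
        rw [(hd t ht).deriv]
        linarith [(hsub t ⟨ht.1.le, ht.2⟩).1]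
    intro t ht
    have hl3 : Tendsto (fun t => R t ^ 2 + K 0 * t) (𝓝[<] T) (𝓝 (0 + K 0 * T)) :=
      hlim2.add ((tendsto_id.mono_left nhdsWithin_le_nhds).const_mul _)
    have := le_of_tendsto hl3 (b := R t ^ 2 + K 0 * t) (by
      filter_upwards [Ioo_mem_nhdsLT ht.2] with s hs
      exact hanti ht ⟨ht.1.trans hs.1.le, hs.2⟩ hs.1.le)
    linarith
  -- compact part
  have hcont : ContinuousOn (fun t => N (R t ^ 2) / R t ^ 2 * (T - t)) (Icc 0 t0) := by
    have hR' := hRc.mono (Icc_subset_Ico_right ht0)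
    have : ContinuousOn (fun t => N (R t ^ 2)) (Icc 0 t0) := fun t ht =>
      ContinuousAt.comp_continuousWithinAt (f := fun t => R t ^ 2) (g := N)
        (hN (R t ^ 2) (Set.mem_Ici.2 (sq_nonneg (R t)))) ((hR'.pow 2) t ht)
    refine (this.div (hR'.pow 2) ?_).mul (by fun_prop)
    intro t ht
    exact pow_ne_zero 2 (hRpos t ⟨ht.1, ht.2.trans_lt ht0⟩).ne'
  obtain ⟨C1, hC1⟩ := isCompact_Icc.bddAbove_image hcont
  refine ⟨max C1 ((|N 0| + 1) / K 0), lt_max_of_lt_right (by positivity), fun t ht => ?_⟩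
  have hTt : 0 < T - t := by linarith [ht.2]
  rw [le_div_iff₀ hTt]
  rcases le_total t t0 with h | h
  · exact le_max_of_le_left (hC1 ⟨t, ⟨ht.1, h⟩, rfl⟩)
  · apply le_max_of_le_right
    have h1 := hlow t ⟨h, ht.2⟩
    have h2 := (hsub t ⟨h, ht.2⟩).2
    have hp := hRpos t ht
    rw [div_mul_eq_mul_div, div_le_div_iff₀ (by positivity) hK0]
    have h3 : N (R t ^ 2) * ((T - t) * K 0) ≤ (|N 0| + 1) * ((T - t) * K 0) := by gcongr
    have h4 : (|N 0| + 1) * (K 0 * (T - t)) ≤ (|N 0| + 1) * R t ^ 2 := by gcongr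
    linarith

/-- along a solution of the mean curvature flow ODE `R' = H(R²)` collapsing to
`0` at the finite time `T`, the squared norm of the second fundamental form satisfies the
Type I bound `|A|²(R(t)²) ≤ C/(T − t)`. -/
theorem mcf_singularity_type_I (m : ℕ) (hm : 2 ≤ m) (g : ℝ → ℝ)
    (hg : ∀ x ∈ Set.Ici (0 : ℝ), AnalyticAt ℝ g x) (hg0 : 0 < deriv g 0)
    (hg1 : ∀ S : ℝ, 0 < S → 0 < 1 / S + deriv g S)
    (hg2 : ∀ S : ℝ, 0 < S → 0 < deriv g S + S * deriv (deriv g) S)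
    (T : ℝ) (hT : 0 < T) (R : ℝ → ℝ)
    (hRpos : ∀ t ∈ Set.Ico (0 : ℝ) T, 0 < R t)
    (hode : ∀ t ∈ Set.Ico (0 : ℝ) T,
      HasDerivWithinAt R (meanCurvature m (fun S => Real.log S + g S) ((R t) ^ 2))
        (Set.Ico (0 : ℝ) T) t)
    (hlim : Filter.Tendsto R (nhdsWithin T (Set.Iio T)) (nhds 0)) :
    ∃ C : ℝ, 0 < C ∧ ∀ t ∈ Set.Ico (0 : ℝ) T,
      normSqSecondFundForm m (fun S => Real.log S + g S) ((R t) ^ 2) ≤ C / (T - t) := by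
  obtain ⟨d1, d2, d3⟩ := aux_derivs g hg
  have hm' : (2:ℝ) ≤ m := by exact_mod_cast hm
  set a : ℝ → ℝ := fun S => deriv g S + S * deriv (deriv g) S with ha
  set b : ℝ → ℝ := fun S => S ^ 2 * deriv (deriv (deriv g)) S + 3 * S * deriv (deriv g) S
    + deriv g S with hb
  set p : ℝ → ℝ := fun S => 1 + S * deriv g S with hp
  have c1 : ∀ S ∈ Set.Ici (0:ℝ), ContinuousAt (deriv g) S := fun S hS =>
    (hg S hS).deriv.continuousAt
  have c2 : ∀ S ∈ Set.Ici (0:ℝ), ContinuousAt (deriv (deriv g)) S := fun S hS =>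
    (hg S hS).deriv.deriv.continuousAt
  have c3 : ∀ S ∈ Set.Ici (0:ℝ), ContinuousAt (deriv (deriv (deriv g))) S := fun S hS =>
    (hg S hS).deriv.deriv.deriv.continuousAt
  have ca : ∀ S ∈ Set.Ici (0:ℝ), ContinuousAt a S := fun S hS => by
    have := c1 S hS; have := c2 S hS; fun_prop
  have cb : ∀ S ∈ Set.Ici (0:ℝ), ContinuousAt b S := fun S hS => by
    have := c1 S hS; have := c2 S hS; have := c3 S hS; fun_prop
  have cp : ∀ S ∈ Set.Ici (0:ℝ), ContinuousAt p S := fun S hS => by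
    have := c1 S hS; fun_prop
  have a0 : a 0 = deriv g 0 := by simp [ha]
  have b0 : b 0 = deriv g 0 := by simp [hb]
  have p0 : p 0 = 1 := by simp [hp]
  have apos : ∀ S ∈ Set.Ici (0:ℝ), 0 < a S := fun S hS => by
    rcases (show (0:ℝ) ≤ S from hS).eq_or_lt with h | h
    · rw [← h, a0]; exact hg0
    · exact hg2 S h
  have ppos : ∀ S ∈ Set.Ici (0:ℝ), 0 < p S := fun S hS => by
    rcases (show (0:ℝ) ≤ S from hS).eq_or_lt with h | h
    · rw [← h, p0]; exact one_pos
    · have := mul_pos h (hg1 S h)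
      have e : S * (1 / S + deriv g S) = p S := by simp only [hp]; field_simp
      rwa [e] at this
  have ea : ∀ S : ℝ, 0 < S → (S⁻¹ + deriv g S) + S * (-(S ^ 2)⁻¹ + deriv (deriv g) S) = a S := by
    intro S hS; simp only [ha]; field_simp; ring
  have eb : ∀ S : ℝ, 0 < S → S ^ 2 * (2 * (S ^ 3)⁻¹ + deriv (deriv (deriv g)) S)
      + 3 * S * (-(S ^ 2)⁻¹ + deriv (deriv g) S) + (S⁻¹ + deriv g S) = b S := by
    intro S hS; simp only [hb]; field_simp; ring
  have eb' : ∀ S : ℝ, 0 < S → (S⁻¹ + deriv g S) + 3 * S * (-(S ^ 2)⁻¹ + deriv (deriv g) S)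
      + S ^ 2 * (2 * (S ^ 3)⁻¹ + deriv (deriv (deriv g)) S) = b S := by
    intro S hS; rw [← eb S hS]; ring
  have ep : ∀ S : ℝ, 0 < S → S⁻¹ + deriv g S = p S / S := by
    intro S hS; simp only [hp]; field_simp
  have key := aux_main T hT R
    (fun S => ((2 * (m:ℝ) - 2) * a S ^ 4 * S ^ 2 + p S ^ 2 * b S ^ 2) / (p S ^ 2 * a S ^ 3))
    (fun S => ((2 * (m:ℝ) - 2) * a S ^ 2 * S + p S * b S)
      / ((2 * (m:ℝ) - 1) * a S ^ ((3:ℝ)/2) * p S)) hRpos ?_ ?_ ?_ ?_ hlim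
  · obtain ⟨C, hC, h⟩ := key
    refine ⟨C, hC, fun t ht => ?_⟩
    refine le_trans (le_of_eq ?_) (h t ht)
    have hR := hRpos t ht
    have hS : 0 < R t ^ 2 := by positivity
    unfold normSqSecondFundForm
    rw [d1 _ hS, d2 _ hS, d3 _ hS, ea _ hS, eb' _ hS, ep _ hS]
    have h1 := apos _ hS.le
    have h2 := ppos _ hS.le
    generalize R t ^ 2 = S at *
    field_simp
  · intro S hS
    have := ca S hS
    have := cb S hS
    have := cp S hS
    have h1 := apos S hS
    have h2 := ppos S hS
    exact ContinuousAt.div (by fun_prop) (by fun_prop) (by positivity)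
  · have hS : (0:ℝ) ∈ Set.Ici (0:ℝ) := by simp
    have := ca 0 hS
    have := cb 0 hS
    have := cp 0 hS
    have h1 := apos 0 hS
    have h2 := ppos 0 hS
    have h3 : ContinuousAt (fun S => a S ^ ((3:ℝ)/2)) 0 := (ca 0 hS).rpow_const (Or.inl h1.ne')
    have h4 : 0 < 2 * (m:ℝ) - 1 := by linarith
    exact ContinuousAt.div (by fun_prop) (by fun_prop) (by positivity)
  · have h4 : 0 < 2 * (m:ℝ) - 1 := by linarith
    simp only [a0, b0, p0]
    have := Real.rpow_pos_of_pos hg0 ((3:ℝ)/2)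
    simp only [mul_zero, zero_add, one_mul, mul_one]
    positivity
  · intro t ht
    have hR := hRpos t ht
    have hS : 0 < R t ^ 2 := by positivity
    convert hode t ht using 1
    unfold meanCurvature
    rw [d1 _ hS, d2 _ hS, d3 _ hS, ea _ hS, eb _ hS, ep _ hS, Real.sqrt_sq hR.le]
    have h1 := Real.rpow_pos_of_pos (apos _ hS.le) ((3:ℝ)/2)
    have h2 := ppos _ hS.le
    have h4 : 0 < 2 * (m:ℝ) - 1 := by linarith
    generalize a (R t ^ 2) ^ ((3:ℝ)/2) = q at *
    generalize a (R t ^ 2) = a' at *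
    generalize b (R t ^ 2) = b' at *
    generalize p (R t ^ 2) = p' at *
    field_simp
end

section
/- For every R₀ > 0 set T = R₀²/2 + (1/3)·log(3·R₀² + 1). Then there exists a differentiable function R : [0, T) → (0, ∞) with R(0) = R₀ and R'(t) = −(1/3)·(3·R(t)² + 1)/(R(t)·(R(t)² + 1)) for all t ∈ [0, T), and every such solution satisfies R(t)²/2 + (1/3)·log(3·R(t)² + 1) = T − t for all t ∈ [0, T); in particular R is strictly decreasing and R(t) → 0 as t → T⁻. -/
noncomputable def burnsF (r : ℝ) : ℝ := r ^ 2 / 2 + (1 / 3) * Real.log (3 * r ^ 2 + 1)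

lemma burnsF_hasDerivAt (r : ℝ) :
    HasDerivAt burnsF (3 * (r * (r ^ 2 + 1)) / (3 * r ^ 2 + 1)) r := by
  have h0 : (3 * r ^ 2 + 1) ≠ 0 := by positivity
  have h1 : HasDerivAt (fun r : ℝ => r ^ 2) (2 * r) r := by
    simpa using hasDerivAt_pow 2 r
  have h2 := (h1.div_const 2).add ((((h1.const_mul 3).add_const 1).log h0).const_mul (1 / 3))
  refine HasDerivAt.congr_deriv h2 ?_
  field_simp
  ring

lemma burnsF_lt {a b : ℝ} (ha : 0 ≤ a) (hab : a < b) : burnsF a < burnsF b := by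
  unfold burnsF
  have h : a ^ 2 < b ^ 2 := by gcongr
  have := Real.log_lt_log (x := 3 * a ^ 2 + 1) (y := 3 * b ^ 2 + 1) (by positivity) (by linarith)
  linarith

lemma burnsF_ge (a : ℝ) : a ^ 2 / 2 ≤ burnsF a := by
  unfold burnsF
  have := Real.log_nonneg (x := 3 * a ^ 2 + 1) (by nlinarith [sq_nonneg a])
  linarith

lemma burnsF_zero : burnsF 0 = 0 := by simp [burnsF]

lemma burnsF_pos {a : ℝ} (ha : 0 < a) : 0 < burnsF a := by
  have := burnsF_lt le_rfl ha
  rwa [burnsF_zero] at this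

lemma burnsF_inj {a b : ℝ} (ha : 0 < a) (hb : 0 < b) (h : burnsF a = burnsF b) : a = b := by
  rcases lt_trichotomy a b with h1 | h1 | h1
  · exact absurd h (burnsF_lt ha.le h1).ne
  · exact h1
  · exact absurd h (burnsF_lt hb.le h1).ne'

lemma burnsF_surj (y : ℝ) : ∃ r, 0 < y → 0 < r ∧ burnsF r = y := by
  by_cases hy : 0 < y
  · have hc : ContinuousOn burnsF (Set.Icc 0 (2 * y + 1)) :=
      fun r _ => (burnsF_hasDerivAt r).continuousAt.continuousWithinAt
    have hm := intermediate_value_Icc (by linarith : (0:ℝ) ≤ 2 * y + 1) hc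
    have h1 := burnsF_ge (2 * y + 1)
    obtain ⟨r, hr, hr2⟩ := hm (show y ∈ _ from ⟨by rw [burnsF_zero]; exact hy.le, by nlinarith⟩)
    refine ⟨r, fun _ => ⟨lt_of_le_of_ne hr.1 ?_, hr2⟩⟩
    rintro rfl
    rw [burnsF_zero] at hr2
    exact hy.ne hr2
  · exact ⟨0, fun h => absurd h hy⟩

/-- for any `R₀ > 0` and `T = R₀²/2 + (1/3)log(3R₀²+1)`, the Burns mean
curvature flow ODE has a solution on `[0, T)` starting at `R₀`, and every such solution
satisfies `R(t)²/2 + (1/3)log(3R(t)²+1) = T − t`; in particular it is strictly decreasing and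
`R(t) → 0` as `t → T⁻`. -/
theorem burns_mcf_collapse_at_singular_time (R₀ T : ℝ) (hR₀ : 0 < R₀)
    (hT : T = R₀ ^ 2 / 2 + (1 / 3) * Real.log (3 * R₀ ^ 2 + 1)) :
    (∃ R : ℝ → ℝ, (∀ t ∈ Set.Ico (0 : ℝ) T, 0 < R t) ∧ R 0 = R₀ ∧
      ∀ t ∈ Set.Ico (0 : ℝ) T, HasDerivWithinAt R
        (-(1 / 3) * (3 * (R t) ^ 2 + 1) / (R t * ((R t) ^ 2 + 1))) (Set.Ico (0 : ℝ) T) t)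
    ∧ ∀ R : ℝ → ℝ, (∀ t ∈ Set.Ico (0 : ℝ) T, 0 < R t) → R 0 = R₀ →
        (∀ t ∈ Set.Ico (0 : ℝ) T, HasDerivWithinAt R
          (-(1 / 3) * (3 * (R t) ^ 2 + 1) / (R t * ((R t) ^ 2 + 1))) (Set.Ico (0 : ℝ) T) t) →
        (∀ t ∈ Set.Ico (0 : ℝ) T,
            (R t) ^ 2 / 2 + (1 / 3) * Real.log (3 * (R t) ^ 2 + 1) = T - t)
          ∧ StrictAntiOn R (Set.Ico (0 : ℝ) T)
          ∧ Filter.Tendsto R (nhdsWithin T (Set.Iio T)) (nhds 0) := by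
  have hTF : T = burnsF R₀ := hT
  have hT0 : 0 < T := hTF ▸ burnsF_pos hR₀
  constructor
  · choose g hg using burnsF_surj
    have hmono : StrictMonoOn g (Set.Ioi 0) := by
      intro x hx y hy hxy
      by_contra hcon
      rcases (not_lt.1 hcon).lt_or_eq with h | h
      · have := burnsF_lt (hg y hy).1.le h
        rw [(hg y hy).2, (hg x hx).2] at this
        linarith
      · have h3 := (hg y hy).2
        rw [h, (hg x hx).2] at h3
        linarith
    have himg : g '' Set.Ioi 0 = Set.Ioi 0 := by
      ext r
      constructor
      · rintro ⟨y, hy, rfl⟩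
        exact (hg y hy).1
      · intro hr
        have hp := burnsF_pos hr
        exact ⟨burnsF r, hp, burnsF_inj (hg _ hp).1 hr (hg _ hp).2⟩
    have hderiv : ∀ y, 0 < y →
        HasDerivAt g (3 * (g y * (g y ^ 2 + 1)) / (3 * g y ^ 2 + 1))⁻¹ y := by
      intro y hy
      have hgy := (hg y hy).1
      have hcont : ContinuousAt g y :=
        hmono.continuousAt_of_image_mem_nhds (Ioi_mem_nhds hy) (by
          rw [himg]; exact Ioi_mem_nhds hgy)
      refine HasDerivAt.of_local_left_inverse hcont (burnsF_hasDerivAt (g y)) (by positivity) ?_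
      filter_upwards [Ioi_mem_nhds hy] with z hz using (hg z hz).2
    refine ⟨fun t => g (T - t), fun t ht => (hg _ (sub_pos.2 ht.2)).1, ?_, fun t ht => ?_⟩
    · simp only [sub_zero]
      exact burnsF_inj (hg _ hT0).1 hR₀ ((hg _ hT0).2.trans hTF)
    · have hp := sub_pos.2 ht.2
      have hgp := (hg _ hp).1
      have h1 := (hderiv _ hp).comp t ((hasDerivAt_id t).const_sub T)
      refine (HasDerivAt.congr_deriv h1 ?_).hasDerivWithinAt
      simp only [id]
      field_simp
  · intro R hpos h0 hd
    have key : ∀ t ∈ Set.Ico (0 : ℝ) T, burnsF (R t) = T - t := by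
      intro t ht
      have hφ : ∀ s ∈ Set.Ico (0 : ℝ) T,
          HasDerivWithinAt (fun s => burnsF (R s) + s) 0 (Set.Ico (0 : ℝ) T) s := by
        intro s hs
        have hp := hpos s hs
        have h1 := ((burnsF_hasDerivAt (R s)).comp_hasDerivWithinAt s (hd s hs)).add
          (hasDerivWithinAt_id s (Set.Ico (0 : ℝ) T))
        refine HasDerivWithinAt.congr_deriv h1 ?_
        field_simp
        ring
      have h2 := (convex_Ico (0 : ℝ) T).norm_image_sub_le_of_norm_hasDerivWithin_le (C := 0) hφ
        (by simp) (Set.left_mem_Ico.2 hT0) ht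
      simp only [zero_mul, norm_le_zero_iff, h0, ← hTF] at h2
      linarith
    refine ⟨key, ?_, ?_⟩
    · intro s hs t ht hst
      by_contra hcon
      have h1 := key s hs
      have h2 := key t ht
      rcases (not_lt.1 hcon).lt_or_eq with h | h
      · have := burnsF_lt (hpos s hs).le h
        linarith
      · rw [h] at h1
        linarith
    · have hlim : Filter.Tendsto (fun t => Real.sqrt (2 * (T - t)))
          (nhdsWithin T (Set.Iio T)) (nhds 0) := by
        have hc : Continuous (fun t : ℝ => Real.sqrt (2 * (T - t))) := by fun_prop
        have := hc.tendsto T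
        simp only [sub_self, mul_zero, Real.sqrt_zero] at this
        exact this.mono_left nhdsWithin_le_nhds
      have hev : ∀ᶠ t in nhdsWithin T (Set.Iio T), t ∈ Set.Ico (0 : ℝ) T :=
        Ico_mem_nhdsLT hT0
      refine squeeze_zero' ?_ ?_ hlim
      · filter_upwards [hev] with t ht using (hpos t ht).le
      · filter_upwards [hev] with t ht
        apply Real.le_sqrt_of_sq_le
        have h1 := key t ht
        have h2 := burnsF_ge (R t)
        linarith
end

section
/- Let R₀ > 0, set T = R₀²/2 + (1/3)·log(3·R₀² + 1), and let R : [0, T) → (0, ∞) be differentiable with R(0) = R₀ and R'(t) = −(1/3)·(3·R(t)² + 1)/(R(t)·(R(t)² + 1)) for all t ∈ [0, T). Then there exists a constant C > 0 such that (2·R(t)⁴ + (R(t)² + 1)²)/(R(t)²·(R(t)² + 1)²) ≤ C/(T − t) for all t ∈ [0, T). -/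
/-- along the Burns mean curvature flow solution on `[0, T)` with
`T = R₀²/2 + (1/3)log(3R₀²+1)`, the squared norm of the second fundamental form
`(2R⁴+(R²+1)²)/(R²(R²+1)²)` satisfies the Type I bound `|A|² ≤ C/(T − t)`. -/
theorem burns_mcf_type_I_singularity (R₀ T : ℝ) (hR₀ : 0 < R₀)
    (hT : T = R₀ ^ 2 / 2 + (1 / 3) * Real.log (3 * R₀ ^ 2 + 1))
    (R : ℝ → ℝ) (hpos : ∀ t ∈ Set.Ico (0 : ℝ) T, 0 < R t) (h0 : R 0 = R₀)
    (hode : ∀ t ∈ Set.Ico (0 : ℝ) T, HasDerivWithinAt R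
      (-(1 / 3) * (3 * (R t) ^ 2 + 1) / (R t * ((R t) ^ 2 + 1))) (Set.Ico (0 : ℝ) T) t) :
    ∃ C : ℝ, 0 < C ∧ ∀ t ∈ Set.Ico (0 : ℝ) T,
      (2 * (R t) ^ 4 + ((R t) ^ 2 + 1) ^ 2) / ((R t) ^ 2 * ((R t) ^ 2 + 1) ^ 2)
        ≤ C / (T - t) := by
  have key : ∀ t ∈ Set.Ico (0 : ℝ) T,
      (R t) ^ 2 / 2 + (1 / 3) * Real.log (3 * (R t) ^ 2 + 1) = T - t := by
    intro t ht
    have hd : ∀ x ∈ Set.Ico (0 : ℝ) T, HasDerivWithinAt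
        (fun s => (R s) ^ 2 / 2 + (1 / 3) * Real.log (3 * (R s) ^ 2 + 1) + s) 0
        (Set.Ico (0 : ℝ) T) x := by
      intro x hx
      have hp := hpos x hx
      have h1 := hode x hx
      have h2 := h1.pow 2
      have h3 : (3 * (R x) ^ 2 + 1) ≠ 0 := by positivity
      have h4 := ((h2.const_mul 3).add_const 1).log h3
      have h5 := ((h2.div_const 2).add (h4.const_mul (1 / 3))).add (hasDerivWithinAt_id x _)
      refine h5.congr_deriv ?_
      have h6 : R x ≠ 0 := hp.ne'
      have h7 : (R x) ^ 2 + 1 ≠ 0 := by positivity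
      simp
      field_simp
      ring
    have h := (convex_Ico (0 : ℝ) T).norm_image_sub_le_of_norm_hasDerivWithin_le (C := 0) hd
      (by simp) ⟨le_refl 0, lt_of_le_of_lt ht.1 ht.2⟩ ht
    rw [zero_mul, norm_le_zero_iff, sub_eq_zero] at h
    simp only [h0] at h
    linarith
  refine ⟨9 / 2, by norm_num, fun t ht => ?_⟩
  have hp := hpos t ht
  have hk := key t ht
  have hl := Real.log_le_sub_one_of_pos (show 0 < 3 * (R t) ^ 2 + 1 by positivity)
  have hT' : 0 < T - t := sub_pos.2 ht.2
  have hb : T - t ≤ 3 / 2 * (R t) ^ 2 := by linarith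
  rw [div_le_div_iff₀ (by positivity) hT']
  have hn : 2 * (R t) ^ 4 + ((R t) ^ 2 + 1) ^ 2 ≤ 3 * ((R t) ^ 2 + 1) ^ 2 := by
    nlinarith [sq_nonneg (R t)]
  calc _ ≤ (3 * ((R t) ^ 2 + 1) ^ 2) * (3 / 2 * (R t) ^ 2) :=
        mul_le_mul hn hb hT'.le (by positivity)
    _ = _ := by ring
end
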